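/- arXiv:2501.18026 — 2 statements merged into one kernel-verified Lean document; each statement's English description precedes it below -/
import Mathlib

section
/- Let v be a time-dependent bounded Lipschitz vector field on ℝ^d with flow Φ^v_{t₀,t}. Then for all t ≥ t₀ and Lebesgue-a.e. x, the Jacobian determinant satisfies exp(−∫_{t₀}^t ‖[div v_s]^−‖_∞ ds) ≤ det DΦ^v_{t₀,t}(x) ≤ exp(∫_{t₀}^t ‖[div v_s]^+‖_∞ ds), where [·]^± denote positive and negative parts. -/
open MeasureTheory Filter Topology

namespace FlowJac

open Set

theorem contDiff_det {E : Type*} [NormedAddCommGroup E] [NormedSpace ℝ E] [FiniteDimensional ℝ E] :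
    ContDiff ℝ 1 (fun f : E →L[ℝ] E => LinearMap.det f.toLinearMap) := by
  classical
  let b := Module.finBasis ℝ E
  have h1 : (fun f : E →L[ℝ] E => LinearMap.det f.toLinearMap) =
      fun f => Matrix.det (LinearMap.toMatrix b b f.toLinearMap) := by
    funext f
    rw [LinearMap.det_toMatrix]
  rw [h1]
  simp only [Matrix.det_apply]
  refine ContDiff.sum fun σ _ => ?_
  refine ContDiff.const_smul _ ?_
  refine contDiff_prod fun i _ => ?_
  let l : (E →L[ℝ] E) →ₗ[ℝ] ℝ :=
    { toFun := fun f => LinearMap.toMatrix b b f.toLinearMap (σ i) i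
      map_add' := by intro f g; simp
      map_smul' := by intro c f; simp }
  exact (LinearMap.toContinuousLinearMap l).contDiff

theorem hasDerivAt_det {E : Type*} [NormedAddCommGroup E] [NormedSpace ℝ E]
    [FiniteDimensional ℝ E] (N : ℝ → E →L[ℝ] E) (A : E →L[ℝ] E) (s : ℝ)
    (h : HasDerivAt N (A * N s) s) :
    HasDerivAt (fun t => LinearMap.det (N t).toLinearMap)
      (LinearMap.trace ℝ E A.toLinearMap * LinearMap.det (N s).toLinearMap) s := by
  classical
  have hd := (contDiff_det (E := E)).differentiable one_ne_zero (N s)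
  have h1 := hd.hasFDerivAt.comp_hasDerivAt s h
  -- the same derivative along a line
  have h2 : HasDerivAt (fun r : ℝ => N s + r • (A * N s)) (A * N s) 0 := by
    simpa using ((hasDerivAt_id (0 : ℝ)).smul_const (A * N s)).const_add (N s)
  have hd' : HasFDerivAt (fun f : E →L[ℝ] E => LinearMap.det f.toLinearMap)
      (fderiv ℝ (fun f : E →L[ℝ] E => LinearMap.det f.toLinearMap) (N s))
      (N s + (0 : ℝ) • (A * N s)) := by simpa using hd.hasFDerivAt
  have h3 := hd'.comp_hasDerivAt (0 : ℝ) h2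
  let b := Module.finBasis ℝ E
  let Mx := LinearMap.toMatrix b b A.toLinearMap
  have h4 : ((fun f : E →L[ℝ] E => LinearMap.det f.toLinearMap) ∘
      fun r : ℝ => N s + r • (A * N s)) = fun r : ℝ =>
      (1 + Matrix.trace Mx * r +
        (Matrix.det (1 + (Polynomial.X : Polynomial ℝ) • Mx.map Polynomial.C)).divX.divX.eval r
          * r ^ 2) * LinearMap.det (N s).toLinearMap := by
    funext r
    rw [← Matrix.det_one_add_smul]
    have : (N s + r • (A * N s)).toLinearMap =
        (LinearMap.id + r • A.toLinearMap) ∘ₗ (N s).toLinearMap := by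
      ext x; simp
    simp only [Function.comp]
    rw [this, LinearMap.det_comp, ← LinearMap.det_toMatrix b]
    simp [Mx]
  have h5 : HasDerivAt (fun r : ℝ =>
      (1 + Matrix.trace Mx * r +
        (Matrix.det (1 + (Polynomial.X : Polynomial ℝ) • Mx.map Polynomial.C)).divX.divX.eval r
          * r ^ 2) * LinearMap.det (N s).toLinearMap)
      (Matrix.trace Mx * LinearMap.det (N s).toLinearMap) 0 := by
    have e1 : HasDerivAt (fun r : ℝ => 1 + Matrix.trace Mx * r) (Matrix.trace Mx) 0 := by
      simpa using ((hasDerivAt_id (0 : ℝ)).const_mul (Matrix.trace Mx)).const_add 1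
    have e2 := ((Matrix.det (1 + (Polynomial.X : Polynomial ℝ) •
      Mx.map Polynomial.C)).divX.divX.hasDerivAt (0 : ℝ)).mul (hasDerivAt_pow 2 (0 : ℝ))
    have e3 := (e1.add e2).mul_const (LinearMap.det (N s).toLinearMap)
    refine e3.congr_deriv ?_
    simp
  rw [h4] at h3
  have h6 := h3.unique h5
  rw [LinearMap.trace_eq_matrix_trace ℝ b]
  rw [h6] at h1
  exact h1

theorem lip_integral {F : Type*} [NormedAddCommGroup F] [NormedSpace ℝ F]
    (f : ℝ → F) (a b : ℝ) (hab : a ≤ b) (C : NNReal) (hf : IntervalIntegrable f volume a b)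
    (hC : ∀ u ∈ Icc a b, ‖f u‖ ≤ C) (c : F) :
    LipschitzOnWith C (fun t => c + ∫ u in a..t, f u) (uIcc a b) := by
  rw [uIcc_of_le hab]
  refine LipschitzOnWith.of_dist_le_mul fun x hx y hy => ?_
  have hi : ∀ z ∈ Icc a b, IntervalIntegrable f volume a z := fun z hz =>
    hf.mono_set (by rw [uIcc_of_le hab, uIcc_of_le hz.1]; exact Icc_subset_Icc_right hz.2)
  rw [dist_add_left, dist_eq_norm, intervalIntegral.integral_interval_sub_left (hi x hx) (hi y hy),
    Real.dist_eq]
  refine intervalIntegral.norm_integral_le_of_norm_le_const fun u hu => hC u ?_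
  have := uIoc_subset_uIcc hu
  exact uIcc_subset_Icc hy hx this

theorem ac_comp {F : Type*} [NormedAddCommGroup F] [NormedSpace ℝ F] [FiniteDimensional ℝ F]
    (g : F → ℝ) (hg : ContDiff ℝ 1 g) (N : ℝ → F) (a b : ℝ) (C : NNReal)
    (hN : LipschitzOnWith C N (uIcc a b)) :
    AbsolutelyContinuousOnInterval (fun t => g (N t)) a b := by
  have : ProperSpace F := FiniteDimensional.proper ℝ F
  obtain ⟨R, hR⟩ := (isCompact_uIcc (a := a) (b := b)).exists_bound_of_continuousOn
    hN.continuousOn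
  obtain ⟨K, hK⟩ := hg.contDiffOn.exists_lipschitzOnWith one_ne_zero
    (convex_closedBall (0 : F) R) (isCompact_closedBall (0 : F) R)
  exact (hK.comp hN (fun x hx => by simpa using hR x hx)).absolutelyContinuousOnInterval

theorem liouville {E : Type*} [NormedAddCommGroup E] [NormedSpace ℝ E]
    [FiniteDimensional ℝ E] (M A : ℝ → E →L[ℝ] E) (a b : ℝ) (hab : a ≤ b) (C D : NNReal)
    (hi : IntervalIntegrable (fun u => A u * M u) volume a b)
    (hC : ∀ u ∈ Icc a b, ‖A u * M u‖ ≤ C)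
    (hti : IntervalIntegrable (fun u => LinearMap.trace ℝ E (A u).toLinearMap) volume a b)
    (hD : ∀ u ∈ Icc a b, ‖LinearMap.trace ℝ E (A u).toLinearMap‖ ≤ D)
    (hM : ∀ t ∈ Icc a b, M t = 1 + ∫ u in a..t, A u * M u) :
    LinearMap.det (M b).toLinearMap =
      Real.exp (∫ u in a..b, LinearMap.trace ℝ E (A u).toLinearMap) := by
  set N : ℝ → E →L[ℝ] E := fun t => 1 + ∫ u in a..t, A u * M u with hN
  set P : ℝ → ℝ := fun t => 0 + ∫ u in a..t, LinearMap.trace ℝ E (A u).toLinearMap with hP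
  have hac1 := ac_comp _ (contDiff_det (E := E)) N a b C (lip_integral _ a b hab C hi hC 1)
  have hac2 := ac_comp (fun r : ℝ => Real.exp (-r)) (Real.contDiff_exp.comp contDiff_neg) P a b D
    (lip_integral _ a b hab D hti hD 0)
  obtain ⟨c, hc⟩ := (hac1.mul hac2).const_of_ae_hasDerivAt_zero (by
    filter_upwards [hi.ae_hasDerivAt_integral, hti.ae_hasDerivAt_integral] with s h1 h2 hs
    have h1' : HasDerivAt N (A s * N s) s := by
      have := (h1 hs a left_mem_uIcc).const_add 1
      rw [uIcc_of_le hab] at hs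
      rw [hM s hs] at this
      exact this
    have h2' : HasDerivAt P (LinearMap.trace ℝ E (A s).toLinearMap) s :=
      (h2 hs a left_mem_uIcc).const_add 0
    have h3 := (hasDerivAt_det N (A s) s h1').mul h2'.neg.exp
    refine h3.congr_deriv ?_
    simp only [Pi.neg_apply]
    ring)
  have ha := hc a left_mem_uIcc
  have hb := hc b right_mem_uIcc
  rw [← ha] at hb
  rw [hM b (right_mem_Icc.2 hab)]
  change LinearMap.det (N b).toLinearMap = _
  have hPb : P b = ∫ u in a..b, LinearMap.trace ℝ E (A u).toLinearMap := by simp [P]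
  have hPa : P a = 0 := by simp [P]
  have hNa : N a = 1 := by simp [N]
  simp only [Pi.mul_apply, hPa, hNa] at hb
  rw [← hPb]
  have h1 : LinearMap.det ((1 : E →L[ℝ] E).toLinearMap) = 1 := by
    simp
  rw [h1, neg_zero, Real.exp_zero, one_mul, Real.exp_neg] at hb
  have := Real.exp_pos (P b)
  field_simp at hb
  linarith

theorem null_preimage {d : ℕ} {f : EuclideanSpace ℝ (Fin d) → EuclideanSpace ℝ (Fin d)}
    {K : NNReal} (hf : AntilipschitzWith K f) {p : EuclideanSpace ℝ (Fin d) → Prop}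
    (hp : ∀ᵐ x ∂(volume : Measure (EuclideanSpace ℝ (Fin d))), p x) :
    ∀ᵐ x ∂(volume : Measure (EuclideanSpace ℝ (Fin d))), p (f x) := by
  have h1 : (volume : Measure (EuclideanSpace ℝ (Fin d))) ≪ Measure.hausdorffMeasure d :=
    Measure.absolutelyContinuous_isAddHaarMeasure _ _
  have h2 : Measure.hausdorffMeasure d ≪ (volume : Measure (EuclideanSpace ℝ (Fin d))) :=
    Measure.absolutelyContinuous_isAddHaarMeasure _ _
  have h3 := h2 hp
  refine h1 ?_
  have h4 := hf.hausdorffMeasure_preimage_le (d := d) (by positivity) {x | ¬ p x}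
  have h5 : Measure.hausdorffMeasure d {x : EuclideanSpace ℝ (Fin d) | ¬ p x} = 0 := h3
  rw [h5, mul_zero] at h4
  exact le_antisymm h4 zero_le

theorem flow_lip {E : Type*} [NormedAddCommGroup E] [NormedSpace ℝ E]
    (v : ℝ → E → E) (t₀ T : ℝ) (K : NNReal)
    (hLip : ∀ τ ∈ Icc t₀ T, LipschitzWith K (v τ)) (φ : ℝ → E → E)
    (h0 : ∀ x, φ t₀ x = x)
    (hode : ∀ x t, t₀ ≤ t → HasDerivAt (fun u => φ u x) (v t (φ t x)) t)
    (u : ℝ) (hu : u ∈ Icc t₀ T) :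
    LipschitzWith (Real.toNNReal (Real.exp (K * (T - t₀)))) (φ u) ∧
    AntilipschitzWith (Real.toNNReal (Real.exp (K * (T - t₀)))) (φ u) := by
  have hexp : Real.exp (K * (u - t₀)) ≤ Real.exp (K * (T - t₀)) := by
    have := hu.2
    gcongr
  constructor
  · refine LipschitzWith.of_dist_le_mul fun x y => ?_
    rw [Real.coe_toNNReal _ (Real.exp_pos _).le]
    have := dist_le_of_trajectories_ODE_of_mem (v := v) (s := fun _ => univ) (K := K)
      (f := fun t => φ t x) (g := fun t => φ t y) (a := t₀) (b := T) (δ := dist x y)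
      (fun t ht => (hLip t (Ico_subset_Icc_self ht)).lipschitzOnWith)
      (fun t ht => (hode x t ht.1).continuousAt.continuousWithinAt)
      (fun t ht => (hode x t ht.1).hasDerivWithinAt) (fun _ _ => trivial)
      (fun t ht => (hode y t ht.1).continuousAt.continuousWithinAt)
      (fun t ht => (hode y t ht.1).hasDerivWithinAt) (fun _ _ => trivial)
      (by simp [h0]) u hu
    calc dist (φ u x) (φ u y) ≤ dist x y * Real.exp (K * (u - t₀)) := this
      _ ≤ dist x y * Real.exp (K * (T - t₀)) := by gcongr
      _ = _ := mul_comm _ _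
  · refine AntilipschitzWith.of_le_mul_dist fun x y => ?_
    rw [Real.coe_toNNReal _ (Real.exp_pos _).le]
    have hd : ∀ x, ∀ t ∈ Icc 0 (u - t₀),
        HasDerivAt (fun τ => φ (u - τ) x) (-v (u - t) (φ (u - t) x)) t := fun x t ht => by
      have := (hode x (u - t) (by linarith [ht.2])).scomp t ((hasDerivAt_id t).const_sub u)
      simpa [Function.comp_def] using this
    have := dist_le_of_trajectories_ODE_of_mem (v := fun τ y => -v (u - τ) y)
      (s := fun _ => univ) (K := K)
      (f := fun t => φ (u - t) x) (g := fun t => φ (u - t) y) (a := 0) (b := u - t₀)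
      (δ := dist (φ u x) (φ u y))
      (fun t ht => ((hLip (u - t) ⟨by linarith [ht.2], by linarith [ht.1, hu.2]⟩).neg).lipschitzOnWith)
      (fun t ht => (hd x t ht).continuousAt.continuousWithinAt)
      (fun t ht => (hd x t (Ico_subset_Icc_self ht)).hasDerivWithinAt) (fun _ _ => trivial)
      (fun t ht => (hd y t ht).continuousAt.continuousWithinAt)
      (fun t ht => (hd y t (Ico_subset_Icc_self ht)).hasDerivWithinAt) (fun _ _ => trivial)
      (by simp) (u - t₀) ⟨by linarith [hu.1], le_rfl⟩
    simp only [sub_sub_cancel, h0, sub_zero] at this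
    calc dist x y ≤ dist (φ u x) (φ u y) * Real.exp (K * (u - t₀)) := this
      _ ≤ dist (φ u x) (φ u y) * Real.exp (K * (T - t₀)) := by gcongr
      _ = _ := mul_comm _ _

end FlowJac

/-- For a time-dependent bounded Lipschitz vector field `v` on `ℝ^d` with
flow `Φ`, if `Cm s` bounds the sup-norm of the negative part of `div v_s` and `Cp s` that
of the positive part (the divergence being the trace of the a.e. defined spatial
derivative), then for `t ≥ t₀` and Lebesgue-a.e. `x`, the flow is differentiable at `x`
and `exp(−∫_{t₀}^t ‖[div v_s]⁻‖_∞ ds) ≤ det DΦ_{t₀,t}(x) ≤ exp(∫_{t₀}^t ‖[div v_s]⁺‖_∞ ds)`. -/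
theorem flow_jacobian_bounds {d : ℕ}
    (v : ℝ → EuclideanSpace ℝ (Fin d) → EuclideanSpace ℝ (Fin d))
    (L : ℝ → NNReal) (hLc : Continuous fun τ => (L τ : ℝ))
    (hcont : Continuous fun q : ℝ × EuclideanSpace ℝ (Fin d) => v q.1 q.2)
    (hbdd : ∀ t, ∃ C, ∀ x, ‖v t x‖ ≤ C)
    (hLip : ∀ τ, LipschitzWith (L τ) (v τ))
    (Φ : ℝ → ℝ → EuclideanSpace ℝ (Fin d) → EuclideanSpace ℝ (Fin d))
    (hΦ0 : ∀ s x₀, Φ s s x₀ = x₀)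
    (hΦode : ∀ s x₀ t, s ≤ t → HasDerivAt (fun u => Φ s u x₀) (v t (Φ s t x₀)) t)
    (Cm Cp : ℝ → ℝ) (hCmc : Continuous Cm) (hCpc : Continuous Cp)
    (hCm : ∀ s x, DifferentiableAt ℝ (v s) x →
      max (-(LinearMap.trace ℝ (EuclideanSpace ℝ (Fin d)) (fderiv ℝ (v s) x).toLinearMap)) 0
        ≤ Cm s)
    (hCp : ∀ s x, DifferentiableAt ℝ (v s) x →
      max (LinearMap.trace ℝ (EuclideanSpace ℝ (Fin d)) (fderiv ℝ (v s) x).toLinearMap) 0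
        ≤ Cp s)
    (t₀ : ℝ) (ht₀ : 0 ≤ t₀) :
    ∀ t, t₀ ≤ t →
      ∀ᵐ x ∂(volume : Measure (EuclideanSpace ℝ (Fin d))),
        DifferentiableAt ℝ (Φ t₀ t) x ∧
        Real.exp (-∫ s in t₀..t, Cm s) ≤
          LinearMap.det (fderiv ℝ (Φ t₀ t) x).toLinearMap ∧
        LinearMap.det (fderiv ℝ (Φ t₀ t) x).toLinearMap ≤
          Real.exp (∫ s in t₀..t, Cp s) := by
  intro T hT
  classical
  -- uniform Lipschitz bound on the time interval
  obtain ⟨K, hK⟩ : ∃ K : NNReal, ∀ τ ∈ Set.Icc t₀ T, L τ ≤ K := by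
    obtain ⟨R, hR⟩ := (isCompact_Icc (a := t₀) (b := T)).exists_bound_of_continuousOn
      hLc.continuousOn
    refine ⟨Real.toNNReal R, fun τ hτ => ?_⟩
    have : (L τ : ℝ) ≤ R := (le_abs_self _).trans (hR τ hτ)
    exact NNReal.le_toNNReal_of_coe_le this
  have hLipK : ∀ τ ∈ Set.Icc t₀ T, LipschitzWith K (v τ) := fun τ hτ =>
    (hLip τ).weaken (hK τ hτ)
  have hfl := FlowJac.flow_lip v t₀ T K hLipK (Φ t₀) (hΦ0 t₀) (fun x t ht => hΦode t₀ x t ht)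
  set K' := Real.toNNReal (Real.exp (K * (T - t₀))) with hK'
  set c : ℝ → ℝ := fun u => max t₀ (min u T) with hc
  have hcc : Continuous c := by fun_prop
  have hcm : ∀ u, c u ∈ Set.Icc t₀ T := fun u =>
    ⟨le_max_left _ _, max_le hT (min_le_right _ _)⟩
  have hcid : ∀ u ∈ Set.Icc t₀ T, c u = u := fun u hu => by
    simp [hc, hu.1, hu.2]
  set Ψ : ℝ → EuclideanSpace ℝ (Fin d) → EuclideanSpace ℝ (Fin d) := fun u x => Φ t₀ (c u) x
    with hΨ
  have hΨl : ∀ u, LipschitzWith K' (Ψ u) := fun u => (hfl _ (hcm u)).1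
  have hΨa : ∀ u, AntilipschitzWith K' (Ψ u) := fun u => (hfl _ (hcm u)).2
  have hΨt : ∀ x, Continuous fun u => Ψ u x := fun x => by
    rw [continuous_iff_continuousAt]
    intro u
    exact ContinuousAt.comp (f := c) (g := fun u => Φ t₀ u x)
      (hΦode t₀ x (c u) (hcm u).1).continuousAt hcc.continuousAt
  have hΨc : Continuous (Function.uncurry Ψ) :=
    continuous_prod_of_continuous_lipschitzWith' _ K' hΨl hΨt
  have hvc : Continuous (Function.uncurry v) := hcont
  have hpair : Continuous (fun p : ℝ × EuclideanSpace ℝ (Fin d) => (p.1, Ψ p.1 p.2)) :=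
    continuous_fst.prodMk hΨc
  -- a.e. differentiability for a.e. time
  have hae : ∀ᵐ x ∂(volume : Measure (EuclideanSpace ℝ (Fin d))), ∀ᵐ u ∂(volume : Measure ℝ),
      DifferentiableAt ℝ (v u) (Ψ u x) ∧ DifferentiableAt ℝ (Ψ u) x := by
    have hm : MeasurableSet {p : ℝ × EuclideanSpace ℝ (Fin d) |
        DifferentiableAt ℝ (v p.1) (Ψ p.1 p.2) ∧ DifferentiableAt ℝ (Ψ p.1) p.2} :=
      ((measurableSet_of_differentiableAt_with_param ℝ hvc).preimage hpair.measurable).inter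
        (measurableSet_of_differentiableAt_with_param ℝ hΨc)
    refine (Measure.ae_ae_comm (μ := (volume : Measure ℝ))
      (ν := (volume : Measure (EuclideanSpace ℝ (Fin d))))
      (p := fun u x => DifferentiableAt ℝ (v u) (Ψ u x) ∧ DifferentiableAt ℝ (Ψ u) x) hm).1 ?_
    refine Eventually.of_forall fun u => ?_
    exact (FlowJac.null_preimage (hΨa u) ((hLip u).ae_differentiableAt)).and
      (hΨl u).ae_differentiableAt
  filter_upwards [hae] with x hx
  set A : ℝ → EuclideanSpace ℝ (Fin d) →L[ℝ] EuclideanSpace ℝ (Fin d) :=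
    fun u => fderiv ℝ (v u) (Ψ u x) with hA
  set M : ℝ → EuclideanSpace ℝ (Fin d) →L[ℝ] EuclideanSpace ℝ (Fin d) :=
    fun u => fderiv ℝ (Ψ u) x with hM
  have hAm : Measurable A :=
    (measurable_fderiv_with_param ℝ hvc).comp
      (measurable_id.prodMk (hΨt x).measurable)
  have hMm : Measurable M :=
    (measurable_fderiv_with_param ℝ hΨc).comp (measurable_id.prodMk measurable_const)
  have hAb : ∀ u ∈ Set.Icc t₀ T, ‖A u‖ ≤ K := fun u hu =>
    norm_fderiv_le_of_lipschitz ℝ (hLipK u hu)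
  have hMb : ∀ u, ‖M u‖ ≤ K' := fun u => norm_fderiv_le_of_lipschitz ℝ (hΨl u)
  have hAMm : Measurable (fun u => A u * M u) := by
    have : Continuous fun p : (EuclideanSpace ℝ (Fin d) →L[ℝ] EuclideanSpace ℝ (Fin d)) ×
      (EuclideanSpace ℝ (Fin d) →L[ℝ] EuclideanSpace ℝ (Fin d)) => p.1 * p.2 := continuous_mul
    exact this.measurable.comp (hAm.prodMk hMm)
  have hvΨc : ∀ y, Continuous fun u => v u (Ψ u y) := fun y =>
    hvc.comp (continuous_id.prodMk (hΨt y))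
  -- integral equation
  have hint : ∀ t ∈ Set.Icc t₀ T, ∀ y, Ψ t y = y + ∫ u in t₀..t, v u (Ψ u y) := by
    intro t ht y
    have h1 : ∫ u in t₀..t, v u (Ψ u y) = Φ t₀ t y - Φ t₀ t₀ y := by
      refine intervalIntegral.integral_eq_sub_of_hasDerivAt (f := fun u => Φ t₀ u y)
        (fun u hu => ?_) ((hvΨc y).intervalIntegrable _ _)
      rw [Set.uIcc_of_le ht.1] at hu
      have h2 := hΦode t₀ y u hu.1
      simp only [hΨ]
      rwa [hcid u ⟨hu.1, hu.2.trans ht.2⟩]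
    rw [h1, hΦ0]
    simp only [hΨ, hcid t ht]
    abel
  -- differentiate under the integral sign
  have hder : ∀ t ∈ Set.Icc t₀ T, IntervalIntegrable (fun u => A u * M u) volume t₀ t ∧
      HasFDerivAt (Ψ t) (1 + ∫ u in t₀..t, A u * M u) x := by
    intro t ht
    have h1 := intervalIntegral.hasFDerivAt_integral_of_dominated_loc_of_lip (𝕜 := ℝ)
      (μ := volume) (a := t₀) (b := t) (F := fun y u => v u (Ψ u y)) (F' := fun u => A u * M u)
      (x₀ := x) (s := Set.univ) (bound := fun _ => ((K * K' : NNReal) : ℝ)) univ_mem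
      (Eventually.of_forall fun y => (hvΨc y).aestronglyMeasurable)
      ((hvΨc x).intervalIntegrable _ _)
      hAMm.aestronglyMeasurable
      (Eventually.of_forall fun u hu => by
        rw [Set.uIoc_of_le ht.1] at hu
        have := ((hLipK u ⟨hu.1.le, hu.2.trans ht.2⟩).comp (hΨl u)).lipschitzOnWith
          (s := Set.univ)
        simpa [Function.comp_def] using this)
      intervalIntegrable_const
      (by
        filter_upwards [hx] with u hu _
        exact hu.1.hasFDerivAt.comp x hu.2.hasFDerivAt)
    refine ⟨h1.1, ?_⟩
    have h2 := (hasFDerivAt_id (𝕜 := ℝ) x).add h1.2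
    have h3 : Ψ t = fun y => y + ∫ u in t₀..t, v u (Ψ u y) := funext (hint t ht)
    rw [h3]
    exact h2
  have hTm : T ∈ Set.Icc t₀ T := ⟨hT, le_rfl⟩
  have hΨT : Ψ T = Φ t₀ T := by simp only [hΨ, hcid T hTm]
  -- the trace
  let tr : (EuclideanSpace ℝ (Fin d) →L[ℝ] EuclideanSpace ℝ (Fin d)) →L[ℝ] ℝ :=
    LinearMap.toContinuousLinearMap
      { toFun := fun f => LinearMap.trace ℝ (EuclideanSpace ℝ (Fin d)) f.toLinearMap
        map_add' := by intro f g; simp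
        map_smul' := by intro r f; simp }
  have htr : ∀ f, LinearMap.trace ℝ (EuclideanSpace ℝ (Fin d)) f.toLinearMap = tr f :=
    fun f => rfl
  have htb : ∀ u ∈ Set.Icc t₀ T, ‖tr (A u)‖ ≤ ((‖tr‖₊ * K : NNReal) : ℝ) := fun u hu => by
    push_cast
    exact (tr.le_opNorm _).trans (mul_le_mul_of_nonneg_left (hAb u hu) (norm_nonneg _))
  have hti : IntervalIntegrable (fun u => tr (A u)) volume t₀ T := by
    refine (intervalIntegrable_const (c := ((‖tr‖₊ * K : NNReal) : ℝ))).mono_fun'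
      (tr.continuous.measurable.comp hAm).aestronglyMeasurable ?_
    rw [Set.uIoc_of_le hT]
    filter_upwards [ae_restrict_mem measurableSet_Ioc] with u hu
    exact htb u (Set.Ioc_subset_Icc_self hu)
  have hdet := FlowJac.liouville M A t₀ T hT (K * K') (‖tr‖₊ * K) (hder T hTm).1
    (fun u hu => by
      push_cast
      exact (norm_mul_le _ _).trans
        (mul_le_mul (hAb u hu) (hMb u) (norm_nonneg _) K.2))
    hti htb (fun t ht => (hder t ht).2.fderiv)
  simp only [htr] at hdet
  have hMT : fderiv ℝ (Φ t₀ T) x = M T := by rw [← hΨT]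
  rw [hMT, hdet]
  refine ⟨hΨT ▸ (hder T hTm).2.differentiableAt, ?_, ?_⟩
  · rw [Real.exp_le_exp, ← intervalIntegral.integral_neg]
    refine intervalIntegral.integral_mono_ae hT (hCmc.neg.intervalIntegrable _ _) hti ?_
    filter_upwards [hx] with u hu
    have h1 := hCm u _ hu.1
    have h2 := (le_max_left _ _).trans h1
    rw [htr] at h2
    simp only [hA]
    linarith
  · rw [Real.exp_le_exp]
    refine intervalIntegral.integral_mono_ae hT hti (hCpc.intervalIntegrable _ _) ?_
    filter_upwards [hx] with u hu
    have h1 := hCp u _ hu.1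
    exact (le_max_left _ _).trans h1
end

section
/- Let S be a Polish space. For every bounded Borel measurable function f : S → ℝ, the map μ ↦ ∫_S f dμ⁺ from the space of finite signed Borel measures (with the Fortet–Mourier norm topology) to ℝ is Borel measurable, where μ⁺ is the positive part of μ in the Hahn–Jordan decomposition. In particular, for every Borel set E ⊂ S, the maps μ ↦ μ⁺(E), μ ↦ μ⁻(E) and μ ↦ μ(E) are Borel measurable on M(S)_FM. -/
open MeasureTheory Filter Topology

/-- Integration of a function against a finite signed measure, via the Jordan decomposition. -/
noncomputable def sintegral {S : Type*} [MeasurableSpace S] (μ : SignedMeasure S) (f : S → ℝ) : ℝ :=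
  (∫ x, f x ∂μ.toJordanDecomposition.posPart) - ∫ x, f x ∂μ.toJordanDecomposition.negPart

/-- Total variation norm of a finite signed measure: `‖μ‖_TV = μ⁺(S) + μ⁻(S)`. -/
noncomputable def tvNorm {S : Type*} [MeasurableSpace S] (μ : SignedMeasure S) : ℝ :=
  (μ.toJordanDecomposition.posPart Set.univ + μ.toJordanDecomposition.negPart Set.univ).toReal

/-- Fortet–Mourier norm: `‖μ‖_FM* = sup {∫ f dμ : f ∈ BL(S), ‖f‖_∞ ≤ 1, |f|_L ≤ 1}`. -/
noncomputable def fmNorm {S : Type*} [MeasurableSpace S] [MetricSpace S]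
    (μ : SignedMeasure S) : ℝ :=
  sSup {r | ∃ f : S → ℝ, (∀ x, |f x| ≤ 1) ∧ LipschitzWith 1 f ∧ r = sintegral μ f}

/-- The signed measure `g·μ` with density `g` with respect to the signed measure `μ`,
i.e. `E ↦ ∫_E g dμ`, defined via the Jordan decomposition of `μ`. -/
noncomputable def densitySM {S : Type*} [MeasurableSpace S]
    (μ : SignedMeasure S) (g : S → ℝ) : SignedMeasure S :=
  μ.toJordanDecomposition.posPart.withDensityᵥ g - μ.toJordanDecomposition.negPart.withDensityᵥ g

/-- The Borel σ-algebra on `M(S)_FM`: the σ-algebra generated by the open balls of the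
Fortet–Mourier metric (for the separable metric space `M(S)_FM` over a Polish `S`, this is
the Borel σ-algebra of the FM-metric topology). -/
noncomputable def fmMeasurableSpace (S : Type*) [MeasurableSpace S] [MetricSpace S] :
    MeasurableSpace (MeasureTheory.SignedMeasure S) :=
  MeasurableSpace.generateFrom
    {B | ∃ (μ₀ : MeasureTheory.SignedMeasure S) (r : ℝ), B = {μ | fmNorm (μ - μ₀) < r}}


section helpers

variable {S : Type*} [MeasurableSpace S]

lemma jm_integrable (m : Measure S) [IsFiniteMeasure m] {f : S → ℝ} (hf : Measurable f) {C : ℝ}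
    (hC : ∀ x, |f x| ≤ C) : Integrable f m :=
  Integrable.of_bound hf.aestronglyMeasurable C (ae_of_all _ hC)

lemma jm_sintegral_eq (μ : SignedMeasure S) (a b : Measure S) [IsFiniteMeasure a]
    [IsFiniteMeasure b] (h : μ = a.toSignedMeasure - b.toSignedMeasure)
    {f : S → ℝ} (hf : Measurable f) {C : ℝ} (hC : ∀ x, |f x| ≤ C) :
    sintegral μ f = (∫ x, f x ∂a) - ∫ x, f x ∂b := by
  have key : μ.toJordanDecomposition.posPart + b = a + μ.toJordanDecomposition.negPart := by
    ext E hE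
    have h1 := SignedMeasure.apply_eq_posPart_real_sub_negPart_real μ hE
    have h2 : μ E = a.real E - b.real E := by
      rw [h, Measure.toSignedMeasure_sub_apply hE]
    rw [← ENNReal.toReal_eq_toReal_iff' (measure_ne_top _ _) (measure_ne_top _ _)]
    have e1 : (μ.toJordanDecomposition.posPart + b).real E
      = μ.toJordanDecomposition.posPart.real E + b.real E := measureReal_add_apply
    have e2 : (a + μ.toJordanDecomposition.negPart).real E
      = a.real E + μ.toJordanDecomposition.negPart.real E := measureReal_add_apply
    change (μ.toJordanDecomposition.posPart + b).real E = (a + μ.toJordanDecomposition.negPart).real E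
    linarith
  have h3 := congrArg (fun m => ∫ x, f x ∂m) key
  beta_reduce at h3
  rw [integral_add_measure (jm_integrable _ hf hC) (jm_integrable _ hf hC),
    integral_add_measure (jm_integrable _ hf hC) (jm_integrable _ hf hC)] at h3
  unfold sintegral
  linarith

lemma jm_self_eq (μ : SignedMeasure S) : μ = μ.toJordanDecomposition.posPart.toSignedMeasure -
    μ.toJordanDecomposition.negPart.toSignedMeasure :=
  (SignedMeasure.toSignedMeasure_toJordanDecomposition μ).symm

lemma jm_sintegral_sub (μ ν : SignedMeasure S) {f : S → ℝ} (hf : Measurable f) {C : ℝ}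
    (hC : ∀ x, |f x| ≤ C) : sintegral (μ - ν) f = sintegral μ f - sintegral ν f := by
  rw [jm_sintegral_eq (μ - ν)
    (μ.toJordanDecomposition.posPart + ν.toJordanDecomposition.negPart)
    (μ.toJordanDecomposition.negPart + ν.toJordanDecomposition.posPart) ?_ hf hC,
    integral_add_measure (jm_integrable _ hf hC) (jm_integrable _ hf hC),
    integral_add_measure (jm_integrable _ hf hC) (jm_integrable _ hf hC)]
  · unfold sintegral; ring
  · rw [Measure.toSignedMeasure_add, Measure.toSignedMeasure_add]
    conv_lhs => rw [jm_self_eq μ, jm_self_eq ν]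
    abel

lemma jm_sintegral_mul (μ : SignedMeasure S) (f : S → ℝ) (c : ℝ) :
    sintegral μ (fun x => c * f x) = c * sintegral μ f := by
  unfold sintegral
  rw [integral_const_mul, integral_const_mul]; ring

lemma jm_sintegral_neg (μ : SignedMeasure S) (f : S → ℝ) :
    sintegral μ (fun x => - f x) = - sintegral μ f := by
  have := jm_sintegral_mul μ f (-1)
  simpa using this

lemma jm_sintegral_le (μ : SignedMeasure S) {f : S → ℝ} (hf : ∀ x, |f x| ≤ 1) :
    sintegral μ f ≤ μ.toJordanDecomposition.posPart.real Set.univ +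
      μ.toJordanDecomposition.negPart.real Set.univ := by
  have h (m : Measure S) [IsFiniteMeasure m] : |∫ x, f x ∂m| ≤ m.real Set.univ := by
    have := norm_integral_le_of_norm_le_const (μ := m) (f := f) (C := 1) (ae_of_all _ hf)
    simpa using this
  have h1 := abs_le.1 (h μ.toJordanDecomposition.posPart)
  have h2 := abs_le.1 (h μ.toJordanDecomposition.negPart)
  unfold sintegral
  linarith

variable [MetricSpace S]

lemma jm_le_fmNorm (μ : SignedMeasure S) {f : S → ℝ} (hf : ∀ x, |f x| ≤ 1)
    (hL : LipschitzWith 1 f) : sintegral μ f ≤ fmNorm μ := by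
  refine le_csSup ⟨μ.toJordanDecomposition.posPart.real Set.univ +
      μ.toJordanDecomposition.negPart.real Set.univ, ?_⟩ ⟨f, hf, hL, rfl⟩
  rintro r ⟨g, hg, -, rfl⟩
  exact jm_sintegral_le μ hg

lemma jm_fmNorm_le (μ : SignedMeasure S) {c : ℝ}
    (h : ∀ f : S → ℝ, (∀ x, |f x| ≤ 1) → LipschitzWith 1 f → sintegral μ f ≤ c) :
    fmNorm μ ≤ c := by
  refine csSup_le ⟨_, fun _ => 0, by simp, LipschitzWith.const' 0, rfl⟩ ?_
  rintro r ⟨g, hg, hL, rfl⟩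
  exact h g hg hL

lemma jm_measurable_fmNorm (ν : SignedMeasure S) :
    Measurable[fmMeasurableSpace S] (fun μ => fmNorm (μ - ν)) := by
  let _ := fmMeasurableSpace S
  refine measurable_of_Iio fun r => ?_
  exact MeasurableSpace.measurableSet_generateFrom ⟨ν, r, rfl⟩

variable [BorelSpace S]

/-- discrete measure -/
noncomputable def jmA (e : ℕ → S) (p : Σ N : ℕ, (Fin N → NNRat)) : Measure S :=
  ∑ k : Fin p.1, ((p.2 k : NNReal) • Measure.dirac (e k))

instance jmA_finite (e : ℕ → S) (p : Σ N : ℕ, (Fin N → NNRat)) : IsFiniteMeasure (jmA e p) := by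
  unfold jmA; infer_instance

lemma jmA_integral (e : ℕ → S) (p : Σ N : ℕ, (Fin N → NNRat)) {f : S → ℝ} (hf : Measurable f)
    {C : ℝ} (hC : ∀ x, |f x| ≤ C) :
    ∫ x, f x ∂(jmA e p) = ∑ k : Fin p.1, (p.2 k : ℝ) * f (e k) := by
  unfold jmA
  rw [integral_finsetSum_measure (fun i _ => jm_integrable _ hf hC)]
  refine Finset.sum_congr rfl fun k _ => ?_
  rw [integral_smul_nnreal_measure, integral_dirac]
  rw [NNReal.smul_def, smul_eq_mul]
  rfl

lemma jm_approx (e : ℕ → S) (he : DenseRange e) (m : Measure S) [IsFiniteMeasure m] {ε : ℝ}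
    (hε : 0 < ε) : ∃ p, ∀ f : S → ℝ, (∀ x, |f x| ≤ 1) → LipschitzWith 1 f →
      |(∫ x, f x ∂m) - ∫ x, f x ∂(jmA e p)| ≤ ε := by
  have hsep : TopologicalSpace.SeparableSpace S := ⟨_, Set.countable_range e, he⟩
  have hsc : SecondCountableTopology S := UniformSpace.secondCountable_of_separable S
  have hmeas : ∀ n, Measurable (fun x => min 2 (dist (SimpleFunc.nearestPt e n x) x)) := fun n =>
    measurable_const.min ((SimpleFunc.measurable _).dist measurable_id)
  have hlim : Tendsto (fun n => ∫ x, min 2 (dist (SimpleFunc.nearestPt e n x) x) ∂m) atTop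
      (𝓝 (∫ _, (0:ℝ) ∂m)) := by
    refine tendsto_integral_of_dominated_convergence (fun _ => 2)
      (fun n => (hmeas n).aestronglyMeasurable) (integrable_const _) ?_ ?_
    · refine fun n => ae_of_all _ fun x => ?_
      rw [Real.norm_of_nonneg (le_min (by norm_num) dist_nonneg)]
      exact min_le_left _ _
    · refine ae_of_all _ fun x => ?_
      have h1 := SimpleFunc.tendsto_nearestPt (e := e) (x := x) (he x)
      have h2 := (tendsto_const_nhds (x := (2:ℝ))).min (tendsto_iff_dist_tendsto_zero.1 h1)
      simpa using h2
  rw [integral_zero] at hlim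
  obtain ⟨N, hN⟩ := (hlim.eventually (gt_mem_nhds (half_pos hε))).exists
  set w : Fin (N+1) → ℝ := fun k => m.real (SimpleFunc.nearestPtInd e N ⁻¹' {(k:ℕ)}) with hw
  have hq : ∀ k, ∃ q : NNRat, |w k - q| ≤ ε / 2 / (N+1) := by
    intro k
    have hpos : 0 < ε / 2 / (N+1) := by positivity
    obtain ⟨q, hq1, hq2⟩ := exists_rat_btwn (lt_add_of_pos_right (w k) hpos)
    have : 0 ≤ w k := measureReal_nonneg
    have hq0 : 0 ≤ q := by exact_mod_cast this.trans hq1.le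
    lift q to NNRat using hq0
    rw [Rat.cast_nnratCast] at hq1 hq2
    refine ⟨q, ?_⟩
    rw [abs_le]; constructor <;> linarith
  choose q hq using hq
  refine ⟨⟨N+1, q⟩, fun f hf hL => ?_⟩
  have hfm : Measurable f := hL.continuous.measurable
  rw [jmA_integral e _ hfm hf]
  have h1 : ∫ x, f (SimpleFunc.nearestPt e N x) ∂m = ∑ k : Fin (N+1), w k * f (e k) := by
    have : ∀ x, f (SimpleFunc.nearestPt e N x) = ∑ k : Fin (N+1),
        (SimpleFunc.nearestPtInd e N ⁻¹' {(k:ℕ)}).indicator (fun _ => f (e k)) x := by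
      intro x
      rw [Finset.sum_eq_single
        (⟨SimpleFunc.nearestPtInd e N x, Nat.lt_succ_of_le (SimpleFunc.nearestPtInd_le e N x)⟩ :
          Fin (N+1))]
      · simp [SimpleFunc.nearestPt]
      · intro b _ hb
        rw [Set.indicator_of_notMem]
        intro hmem
        exact hb (Fin.ext hmem.symm)
      · simp
    simp_rw [this]
    rw [integral_finsetSum]
    · refine Finset.sum_congr rfl fun k _ => ?_
      rw [integral_indicator_const _ (SimpleFunc.measurableSet_preimage _ _)]
      rfl
    · intro k _
      exact (integrable_const _).indicator (SimpleFunc.measurableSet_preimage _ _)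
  have h2 : |(∫ x, f x ∂m) - ∫ x, f (SimpleFunc.nearestPt e N x) ∂m| ≤ ε / 2 := by
    rw [← integral_sub (jm_integrable _ hfm hf)
      (jm_integrable m (f := fun x => f (SimpleFunc.nearestPt e N x))
        (hfm.comp (SimpleFunc.measurable _)) (fun x => hf _))]
    rw [← Real.norm_eq_abs]
    refine le_trans (norm_integral_le_of_norm_le (g := fun x =>
      min 2 (dist (SimpleFunc.nearestPt e N x) x)) ?_ (ae_of_all _ fun x => ?_)) hN.le
    · refine jm_integrable m (hmeas N) (C := 2) fun x => ?_
      rw [abs_of_nonneg (le_min (by norm_num) dist_nonneg)]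
      exact min_le_left _ _
    · refine le_min ?_ ?_
      · have a1 := abs_le.1 (hf x)
        have a2 := abs_le.1 (hf (SimpleFunc.nearestPt e N x))
        rw [Real.norm_eq_abs, abs_le]; constructor <;> linarith
      · have := hL.dist_le_mul x (SimpleFunc.nearestPt e N x)
        rw [dist_comm (SimpleFunc.nearestPt e N x)]
        simpa [Real.dist_eq] using this
  have h3 : |∑ k : Fin (N+1), w k * f (e k) - ∑ k : Fin (N+1), (q k : ℝ) * f (e k)| ≤ ε / 2 := by
    rw [← Finset.sum_sub_distrib]
    refine (Finset.abs_sum_le_sum_abs _ _).trans ?_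
    calc _ ≤ ∑ k : Fin (N+1), ε / 2 / (N+1) := by
            refine Finset.sum_le_sum fun k _ => ?_
            rw [← sub_mul, abs_mul]
            calc _ ≤ |w k - q k| * 1 := by gcongr; exact hf _
              _ ≤ _ := by rw [mul_one]; exact hq k
      _ = ε / 2 := by
            simp; field_simp
  rw [h1] at h2
  have := abs_sub_le (∫ x, f x ∂m) (∑ k : Fin (N+1), w k * f (e k))
    (∑ k : Fin (N+1), (q k : ℝ) * f (e k))
  linarith

/-- countable dense family of signed measures -/
noncomputable def jmD (e : ℕ → S)
    (p : (Σ N : ℕ, (Fin N → NNRat)) × (Σ N : ℕ, (Fin N → NNRat))) : SignedMeasure S :=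
  (jmA e p.1).toSignedMeasure - (jmA e p.2).toSignedMeasure

lemma jm_dense (e : ℕ → S) (he : DenseRange e) (μ : SignedMeasure S) {ε : ℝ}
    (hε : 0 < ε) : ∃ p, fmNorm (μ - jmD e p) ≤ ε := by
  obtain ⟨p, hp⟩ := jm_approx e he μ.toJordanDecomposition.posPart (half_pos hε)
  obtain ⟨q, hq⟩ := jm_approx e he μ.toJordanDecomposition.negPart (half_pos hε)
  refine ⟨(p, q), jm_fmNorm_le _ fun f hf hL => ?_⟩
  have hfm : Measurable f := hL.continuous.measurable
  rw [jm_sintegral_sub _ _ hfm hf, jm_sintegral_eq (jmD e (p, q)) _ _ rfl hfm hf]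
  have h1 := abs_le.1 (hp f hf hL)
  have h2 := abs_le.1 (hq f hf hL)
  unfold sintegral
  linarith

lemma jm_meas_lip (e : ℕ → S) (he : DenseRange e) {f : S → ℝ} (hf : ∀ x, |f x| ≤ 1)
    (hL : LipschitzWith 1 f) :
    Measurable[fmMeasurableSpace S] (fun μ : SignedMeasure S => sintegral μ f) := by
  let _ := fmMeasurableSpace S
  have hfm : Measurable f := hL.continuous.measurable
  refine measurable_of_Iio fun a => ?_
  have : (fun μ : SignedMeasure S => sintegral μ f) ⁻¹' Set.Iio a =
      ⋃ p, {μ : SignedMeasure S | sintegral (jmD e p) f + fmNorm (μ - jmD e p) < a} := by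
    ext μ
    simp only [Set.mem_preimage, Set.mem_Iio, Set.mem_iUnion, Set.mem_ofPred_eq]
    constructor
    · intro h
      obtain ⟨p, hp⟩ := jm_dense e he μ (ε := (a - sintegral μ f) / 3) (by linarith)
      refine ⟨p, ?_⟩
      have := jm_le_fmNorm (μ - jmD e p) (f := fun x => - f x) (by simpa using hf) hL.neg
      rw [jm_sintegral_neg, jm_sintegral_sub _ _ hfm hf] at this
      linarith
    · rintro ⟨p, hp⟩
      have := jm_le_fmNorm (μ - jmD e p) hf hL
      rw [jm_sintegral_sub _ _ hfm hf] at this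
      linarith
  rw [this]
  exact MeasurableSet.iUnion fun p =>
    measurableSet_lt ((jm_measurable_fmNorm _).const_add _) measurable_const

lemma jm_meas_closed (e : ℕ → S) (he : DenseRange e) {F : Set S} (hF : IsClosed F) :
    Measurable[fmMeasurableSpace S] (fun μ : SignedMeasure S => μ F) := by
  let _ := fmMeasurableSpace S
  set δ : ℕ → ℝ := fun n => 1 / ((n:ℝ) + 1) with hδ
  have hpos : ∀ n, 0 < δ n := fun n => by positivity
  have hlim : Tendsto δ atTop (𝓝 0) := tendsto_one_div_add_atTop_nhds_zero_nat
  set g : ℕ → S → ℝ := fun n x => (thickenedIndicator (hpos n) F x : ℝ) with hg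
  have hgm : ∀ n, Measurable (g n) := fun n =>
    (NNReal.continuous_coe.comp (thickenedIndicator (hpos n) F).continuous).measurable
  have hg1 : ∀ n x, |g n x| ≤ 1 := fun n x => by
    rw [abs_of_nonneg (NNReal.coe_nonneg _)]
    exact_mod_cast thickenedIndicator_le_one (hpos n) F x
  refine measurable_of_tendsto_metrizable (f := fun n μ => sintegral μ (g n)) (fun n => ?_) ?_
  · have h1 : Measurable (fun μ : SignedMeasure S => sintegral μ (fun x => δ n * g n x)) := by
      refine jm_meas_lip e he (fun x => ?_) ?_
      · have : δ n ≤ 1 := by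
          rw [hδ]; simp only; rw [div_le_one (by positivity)]; linarith [(n.cast_nonneg : (0:ℝ) ≤ n)]
        rw [abs_mul, abs_of_pos (hpos n)]
        exact mul_le_one₀ this (abs_nonneg _) (hg1 n x)
      · refine LipschitzWith.of_dist_le_mul fun x y => ?_
        have := (lipschitzWith_thickenedIndicator (hpos n) F).dist_le_mul x y
        rw [NNReal.dist_eq, NNReal.coe_inv, Real.coe_toNNReal _ (hpos n).le] at this
        rw [Real.dist_eq, ← mul_sub, abs_mul, abs_of_pos (hpos n)]
        calc _ ≤ δ n * ((δ n)⁻¹ * dist x y) := by gcongr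
          _ = _ := by rw [mul_inv_cancel_left₀ (hpos n).ne']; simp
    have h2 := h1.const_mul (δ n)⁻¹
    convert h2 using 2 with μ
    rw [jm_sintegral_mul, inv_mul_cancel_left₀ (hpos n).ne']
  · rw [tendsto_pi_nhds]
    intro μ
    have h (m : Measure S) [IsFiniteMeasure m] :
        Tendsto (fun n => ∫ x, g n x ∂m) atTop (𝓝 (m.real F)) := by
      rw [← integral_indicator_one hF.measurableSet]
      refine tendsto_integral_of_dominated_convergence (fun _ => 1)
        (fun n => (hgm n).aestronglyMeasurable) (integrable_const _)
        (fun n => ae_of_all _ (hg1 n)) (ae_of_all _ fun x => ?_)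
      have h1 := tendsto_pi_nhds.1 (thickenedIndicator_tendsto_indicator_closure hpos hlim F) x
      rw [hF.closure_eq] at h1
      have h2 := (NNReal.continuous_coe.tendsto _).comp h1
      have h3 : ((F.indicator (fun _ => (1 : NNReal)) x : NNReal) : ℝ) =
          F.indicator (1 : S → ℝ) x := by
        by_cases hx : x ∈ F <;> simp [hx]
      rw [h3] at h2
      exact h2
    rw [SignedMeasure.apply_eq_posPart_real_sub_negPart_real μ hF.measurableSet]
    exact (h _).sub (h _)

lemma jm_meas_apply (e : ℕ → S) (he : DenseRange e) {E : Set S} (hE : MeasurableSet E) :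
    Measurable[fmMeasurableSpace S] (fun μ : SignedMeasure S => μ E) := by
  let _ := fmMeasurableSpace S
  induction E, hE using MeasurableSpace.induction_on_inter
    (‹BorelSpace S›.measurable_eq.trans borel_eq_generateFrom_isClosed) isPiSystem_isClosed with
  | empty => simp
  | basic t ht => exact jm_meas_closed e he ht
  | compl t ht h =>
    have : (fun μ : SignedMeasure S => μ tᶜ) = fun μ => μ Set.univ - μ t := by
      ext μ
      rw [← VectorMeasure.of_add_of_sdiff ht MeasurableSet.univ (Set.subset_univ t),
        Set.compl_eq_univ_sdiff]
      ring
    rw [this]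
    exact (jm_meas_closed e he isClosed_univ).sub h
  | iUnion f hd hm h =>
    refine measurable_of_tendsto_metrizable
      (f := fun n (μ : SignedMeasure S) => ∑ i ∈ Finset.range n, μ (f i))
      (fun n => Finset.measurable_fun_sum _ fun i _ => h i) ?_
    rw [tendsto_pi_nhds]
    intro μ
    exact (VectorMeasure.hasSum_of_disjoint_iUnion hm hd).tendsto_sum_nat

lemma jm_pos_eq_iff {A : Set (Set S)} (hA : IsSetAlgebra A)
    (hgen : ‹MeasurableSpace S› = MeasurableSpace.generateFrom A) (μ : SignedMeasure S)
    {E : Set S} (hE : MeasurableSet E) (a : ℝ) :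
    a < μ.toJordanDecomposition.posPart.real E ↔ ∃ B ∈ A, a < μ (B ∩ E) := by
  have hAm : ∀ B ∈ A, MeasurableSet B := fun B hB => hgen ▸
    MeasurableSpace.measurableSet_generateFrom hB
  set P := μ.toJordanDecomposition.posPart with hP
  set Q := μ.toJordanDecomposition.negPart with hQ
  have happ : ∀ B, MeasurableSet B → μ B = P.real B - Q.real B := fun B hB =>
    SignedMeasure.apply_eq_posPart_real_sub_negPart_real μ hB
  constructor
  · intro h
    obtain ⟨T, hT, hPT, hQT⟩ := μ.toJordanDecomposition.mutuallySingular
    rw [← hP] at hPT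
    rw [← hQ] at hQT
    obtain ⟨B, hB, hlt⟩ := (Measure.MeasureDense.of_generateFrom_isSetAlgebra_finite (μ := P + Q)
      hA hgen).approx Tᶜ hT.compl (measure_ne_top _ _) (P.real E - a) (by linarith)
    refine ⟨B, hB, ?_⟩
    have hBm := hAm B hB
    have hlt' : (P + Q).real (symmDiff Tᶜ B) < P.real E - a :=
      (ENNReal.lt_ofReal_iff_toReal_lt (measure_ne_top _ _)).1 hlt
    rw [measureReal_add_apply] at hlt'
    rw [happ _ (hBm.inter hE)]
    -- P E ≤ P (B ∩ E) + P (symmDiff) and Q (B ∩ E) ≤ Q (symmDiff)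
    have h1 : P.real E ≤ P.real (B ∩ E) + P.real (symmDiff Tᶜ B) := by
      have : E ⊆ ((B ∩ E) ∪ symmDiff Tᶜ B) ∪ T := by
        intro x hx
        by_cases hxT : x ∈ T
        · exact Or.inr hxT
        · left
          by_cases hxB : x ∈ B
          · exact Or.inl ⟨hxB, hx⟩
          · exact Or.inr (Or.inl ⟨hxT, hxB⟩)
      have a1 := measureReal_mono (μ := P) this
      have a2 := measureReal_union_le (μ := P) ((B ∩ E) ∪ symmDiff Tᶜ B) T
      have a3 := measureReal_union_le (μ := P) (B ∩ E) (symmDiff Tᶜ B)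
      have a4 : P.real T = 0 := by simp [measureReal_def, hPT]
      linarith
    have h2 : Q.real (B ∩ E) ≤ Q.real (symmDiff Tᶜ B) := by
      have : B ∩ E ⊆ symmDiff Tᶜ B ∪ Tᶜ := by
        intro x hx
        by_cases hxT : x ∈ T
        · exact Or.inl (Or.inr ⟨hx.1, fun h => h hxT⟩)
        · exact Or.inr hxT
      have a1 := measureReal_mono (μ := Q) this
      have a2 := measureReal_union_le (μ := Q) (symmDiff Tᶜ B) Tᶜ
      have a4 : Q.real Tᶜ = 0 := by simp [measureReal_def, hQT]
      linarith
    linarith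
  · rintro ⟨B, hB, hlt⟩
    rw [happ _ ((hAm B hB).inter hE)] at hlt
    have h1 : P.real (B ∩ E) ≤ P.real E := measureReal_mono Set.inter_subset_right
    have h2 : 0 ≤ Q.real (B ∩ E) := measureReal_nonneg
    linarith

lemma jm_meas_pos (e : ℕ → S) (he : DenseRange e) {E : Set S} (hE : MeasurableSet E) :
    Measurable[fmMeasurableSpace S]
      (fun μ : SignedMeasure S => (μ.toJordanDecomposition.posPart E).toReal) := by
  let _ := fmMeasurableSpace S
  have hsep : TopologicalSpace.SeparableSpace S := ⟨_, Set.countable_range e, he⟩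
  have hsc : SecondCountableTopology S := UniformSpace.secondCountable_of_separable S
  have hcg : MeasurableSpace.CountablyGenerated S := inferInstance
  set A := generateSetAlgebra (MeasurableSpace.countableGeneratingSet S)
  have hA : IsSetAlgebra A := isSetAlgebra_generateSetAlgebra
  have hc : A.Countable :=
    countable_generateSetAlgebra MeasurableSpace.countable_countableGeneratingSet
  have hgen : ‹MeasurableSpace S› = MeasurableSpace.generateFrom A := by
    rw [generateFrom_generateSetAlgebra_eq, MeasurableSpace.generateFrom_countableGeneratingSet]
  refine measurable_of_Ioi fun a => ?_
  have : (fun μ : SignedMeasure S => (μ.toJordanDecomposition.posPart E).toReal) ⁻¹' Set.Ioi a =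
      ⋃ B ∈ A, {μ : SignedMeasure S | a < μ (B ∩ E)} := by
    ext μ
    simp only [Set.mem_preimage, Set.mem_Ioi, Set.mem_iUnion, Set.mem_ofPred_eq, exists_prop]
    exact jm_pos_eq_iff hA hgen μ hE a
  rw [this]
  refine MeasurableSet.biUnion hc fun B hB => ?_
  have hBm : MeasurableSet B := by
    rw [hgen]; exact MeasurableSpace.measurableSet_generateFrom hB
  exact measurableSet_lt measurable_const (jm_meas_apply e he (hBm.inter hE))

lemma jm_meas_integral (e : ℕ → S) (he : DenseRange e) {f : S → ℝ} (hf : Measurable f)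
    {C : ℝ} (hC : ∀ x, |f x| ≤ C) :
    Measurable[fmMeasurableSpace S]
      (fun μ : SignedMeasure S => ∫ x, f x ∂μ.toJordanDecomposition.posPart) := by
  let _ := fmMeasurableSpace S
  have h1 : Measurable (fun μ : SignedMeasure S => μ.toJordanDecomposition.posPart) := by
    refine Measure.measurable_of_measurable_coe _ fun E hE => ?_
    have := (jm_meas_pos e he hE).ennreal_ofReal
    simpa only [ENNReal.ofReal_toReal (measure_ne_top _ _)] using this
  have h2 : (fun μ : SignedMeasure S => ∫ x, f x ∂μ.toJordanDecomposition.posPart) =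
      fun μ => (∫⁻ x, ENNReal.ofReal (f x) ∂μ.toJordanDecomposition.posPart).toReal -
        (∫⁻ x, ENNReal.ofReal (-f x) ∂μ.toJordanDecomposition.posPart).toReal := by
    ext μ
    exact integral_eq_lintegral_pos_part_sub_lintegral_neg_part (jm_integrable _ hf hC)
  rw [h2]
  exact (((Measure.measurable_lintegral hf.ennreal_ofReal).comp h1).ennreal_toReal).sub
    (((Measure.measurable_lintegral hf.neg.ennreal_ofReal).comp h1).ennreal_toReal)

end helpers

/-- On a Polish space `S`, for every bounded Borel function `f : S → ℝ`, the
map `μ ↦ ∫ f dμ⁺` is Borel measurable on `M(S)_FM` (with the σ-algebra of the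
Fortet–Mourier topology), where `μ⁺` is the positive part in the Hahn–Jordan
decomposition. In particular, for every Borel set `E`, the maps `μ ↦ μ⁺(E)`, `μ ↦ μ⁻(E)`
and `μ ↦ μ(E)` are Borel measurable on `M(S)_FM`. -/
theorem jordan_measurable {S : Type*} [MeasurableSpace S] [MetricSpace S] [PolishSpace S]
    [BorelSpace S] :
    (∀ f : S → ℝ, Measurable f → (∃ C, ∀ x, |f x| ≤ C) →
      @Measurable _ _ (fmMeasurableSpace S) _
        (fun μ : SignedMeasure S => ∫ x, f x ∂μ.toJordanDecomposition.posPart)) ∧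
    ∀ E : Set S, MeasurableSet E →
      (@Measurable _ _ (fmMeasurableSpace S) _
        (fun μ : SignedMeasure S => (μ.toJordanDecomposition.posPart E).toReal)) ∧
      (@Measurable _ _ (fmMeasurableSpace S) _
        (fun μ : SignedMeasure S => (μ.toJordanDecomposition.negPart E).toReal)) ∧
      (@Measurable _ _ (fmMeasurableSpace S) _
        (fun μ : SignedMeasure S => μ E)) := by
  rcases isEmpty_or_nonempty S with hS | hS
  · have hsub : ∀ μ ν : SignedMeasure S, μ = ν := by
      intro μ ν
      ext E _
      rw [Set.eq_empty_of_isEmpty E, VectorMeasure.empty, VectorMeasure.empty]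
    have hall : ∀ g : SignedMeasure S → ℝ, @Measurable _ _ (fmMeasurableSpace S) _ g := by
      intro g
      let _ := fmMeasurableSpace S
      exact measurable_const' fun μ ν => by rw [hsub μ ν]
    exact ⟨fun f _ _ => hall _, fun E _ => ⟨hall _, hall _, hall _⟩⟩
  · have he := TopologicalSpace.denseRange_denseSeq S
    refine ⟨fun f hf ⟨C, hC⟩ => jm_meas_integral _ he hf hC, fun E hE =>
      ⟨jm_meas_pos _ he hE, ?_, jm_meas_apply _ he hE⟩⟩
    let _ := fmMeasurableSpace S
    have h := (jm_meas_pos _ he hE).sub (jm_meas_apply _ he hE)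
    have h2 : (fun μ : SignedMeasure S => (μ.toJordanDecomposition.negPart E).toReal) =
        fun μ => (μ.toJordanDecomposition.posPart E).toReal - μ E := by
      ext μ
      have := SignedMeasure.apply_eq_posPart_real_sub_negPart_real μ hE
      simp only [measureReal_def] at this
      linarith
    rw [h2]
    exact h
end
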